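/- Let q ≥ 2, m ≥ 1, and let i be an integer with 0 < i < q^m. Write the characteristic polynomial of A_m(i) (the matrix A_m with the first i rows and columns removed) as f_i^m(x). Then f_i^m(x) = g_i^m(x) · x^{q^m − m − i}, where g_i^m(x) = x^m − a₁ x^{m−1} − ⋯ − a_m and a₁ a₂ ⋯ a_m is the base-q expansion of q^m − ī_m (so 0 ≤ a_j < q and q^m − ī_m = Σ_j a_j q^{m−j}). In particular g_i^m(q) = ī_m. -/

import Mathlib

/-- `pt q n s = ⌊n / q^s⌋` (the "part"). -/
def pt (q n s : ℕ) : ℕ := n / q ^ s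

/-- `rs q n s = n mod q^s` (the "residue"). -/
def rs (q n s : ℕ) : ℕ := n % q ^ s

/-- `lm q m n = min { j | 1 ≤ j ≤ m and part(n,j) ≥ res(n, m-j) }`. -/
noncomputable def lm (q m n : ℕ) : ℕ :=
  sInf {j : ℕ | 1 ≤ j ∧ j ≤ m ∧ rs q n (m - j) ≤ pt q n j}

/-- The minimal prefix `n̄_m = n - res(n, m - l_m(n))`. -/
noncomputable def mp (q m n : ℕ) : ℕ := n - rs q n (m - lm q m n)

/-- The 0-1 matrix `A_m`, 0-indexed: entry `(i,j)` is `1` iff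
`res(i, m-1) = part(j, 1)` (indices shifted down by one from the paper). -/
def A (q m : ℕ) : Matrix (Fin (q ^ m)) (Fin (q ^ m)) ℤ :=
  Matrix.of fun i j => if rs q i.val (m - 1) = pt q j.val 1 then 1 else 0

/-- `A_m(i)`: the matrix `A_m` with its first `i` rows and columns removed. -/
def Adel (q m i : ℕ) (h : i ≤ q ^ m) : Matrix (Fin (q ^ m - i)) (Fin (q ^ m - i)) ℤ :=
  (A q m).submatrix (fun a => ⟨a.val + i, by omega⟩) (fun a => ⟨a.val + i, by omega⟩)

section NilpotentUpdate

open Polynomial Matrix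

variable {ι : Type*} [Fintype ι] [DecidableEq ι]

/-- Characteristic polynomial of a rank-one update of a nilpotent matrix. -/
theorem charpoly_add_vecMulVec_of_pow_eq_zero (P : Matrix ι ι ℤ) (u v : ι → ℤ) (m : ℕ)
    (hP : P ^ m = 0) :
    (P + vecMulVec u v).charpoly * X ^ m =
      (X ^ m - ∑ k ∈ Finset.range m, C (v ⬝ᵥ (P ^ k *ᵥ u)) * X ^ (m - (k + 1)))
        * X ^ Fintype.card ι := by
  have hchar : P.charpoly = X ^ Fintype.card ι := by
    have h := Matrix.isNilpotent_charpoly_sub_pow_of_isNilpotent (M := P) ⟨m, hP⟩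
    exact sub_eq_zero.mp h.eq_zero
  let f : ℤ[X] →+* FractionRing ℤ[X] := algebraMap _ _
  have hf : Function.Injective f := IsFractionRing.injective _ _
  have hx : f X ≠ 0 := by
    rw [Ne, map_eq_zero_iff f hf]; exact X_ne_zero
  set B : Matrix ι ι (FractionRing ℤ[X]) := f.mapMatrix P.charmatrix with hB
  have hBdet : B.det = f X ^ Fintype.card ι := by
    rw [hB, ← RingHom.map_det]
    change f P.charpoly = _
    rw [hchar, map_pow]
  have hBunit : IsUnit B.det := by
    rw [hBdet]; exact (pow_ne_zero _ hx).isUnit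
  let g : ℤ →+* FractionRing ℤ[X] := f.comp C
  have hBeq : B = scalar ι (f X) - g.mapMatrix P := by
    rw [hB, charmatrix, map_sub]
    congr 1
    ext a b
    by_cases h : a = b <;> simp [h]
  set S : Matrix ι ι (FractionRing ℤ[X]) :=
    ∑ k ∈ Finset.range m, scalar ι (f X) ^ k * g.mapMatrix P ^ (m - 1 - k) with hS
  have hBS : B * S = f X ^ m • (1 : Matrix ι ι (FractionRing ℤ[X])) := by
    have hc : Commute (scalar ι (f X)) (g.mapMatrix P) :=
      scalar_commute _ (fun r => Commute.all _ _) _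
    rw [hBeq, hS, hc.mul_geom_sum₂, ← map_pow g.mapMatrix, hP, map_zero, sub_zero, ← map_pow,
      scalar_apply, smul_one_eq_diagonal]
  have hinv : B⁻¹ = (f X ^ m)⁻¹ • S := by
    apply inv_eq_right_inv
    rw [Matrix.mul_smul, hBS, smul_smul, inv_mul_cancel₀ (pow_ne_zero _ hx), one_smul]
  have hupd : f.mapMatrix (P + vecMulVec u v).charmatrix =
      B + replicateCol Unit (fun a => - g (u a)) * replicateRow Unit (fun a => g (v a)) := by
    ext a b
    by_cases h : a = b <;>
      simp [hB, h, Matrix.mul_apply, vecMulVec_apply, g] <;> ring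
  have hS' : ∑ a, g (v a) * (S *ᵥ fun a => - g (u a)) a =
      - f (∑ k ∈ Finset.range m, C (v ⬝ᵥ (P ^ k *ᵥ u)) * X ^ (m - (k + 1))) := by
    have hu : (fun a => - g (u a)) = - (g ∘ u) := rfl
    change (g ∘ v) ⬝ᵥ _ = _
    rw [hu, mulVec_neg, dotProduct_neg, hS, Matrix.sum_mulVec, dotProduct_sum, map_sum]
    congr 1
    rw [← Finset.sum_range_reflect]
    refine Finset.sum_congr rfl fun k hk => ?_
    have hk' := Finset.mem_range.mp hk
    have h1 : m - 1 - (m - 1 - k) = k := by omega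
    have h2 : m - 1 - k = m - (k + 1) := by omega
    rw [h1, h2, ← map_pow g.mapMatrix, ← map_pow, ← mulVec_mulVec, scalar_apply,
      RingHom.mapMatrix_apply]
    have h3 : (P ^ k).map g *ᵥ (g ∘ u) = g ∘ (P ^ k *ᵥ u) := by
      ext a; exact (RingHom.map_mulVec g _ _ a).symm
    rw [h3, map_mul, map_pow]
    have h4 : f (C (v ⬝ᵥ (P ^ k *ᵥ u))) = (g ∘ v) ⬝ᵥ (g ∘ (P ^ k *ᵥ u)) :=
      RingHom.map_dotProduct g _ _
    rw [h4, dotProduct, dotProduct, Finset.sum_mul]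
    refine Finset.sum_congr rfl fun a _ => ?_
    rw [mulVec_diagonal]
    ring
  apply hf
  rw [map_mul, map_mul, map_sub, map_pow, map_pow, Matrix.charpoly, RingHom.map_det, hupd,
    det_add_replicateCol_mul_replicateRow hBunit, hBdet, hinv]
  have h5 : (1 + replicateRow Unit (fun a => g (v a)) * ((f X ^ m)⁻¹ • S) *
      replicateCol Unit (fun a => - g (u a))).det =
      1 + (f X ^ m)⁻¹ * ∑ a, g (v a) * (S *ᵥ fun a => - g (u a)) a := by
    rw [det_unique, Matrix.mul_assoc, Matrix.smul_mul, Matrix.mul_smul, ← replicateCol_mulVec]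
    simp [Matrix.mul_apply]
  rw [h5, hS']
  have := pow_ne_zero m hx
  field_simp
  ring

end NilpotentUpdate

section FunctionalGraph

open Matrix

variable {ι : Type*} [Fintype ι] [DecidableEq ι]

/-- Adjacency matrix of the graph of `φ`, with the edges into `z` deleted. -/
def cutGraph (φ : ι → ι) (z : ι) : Matrix ι ι ℤ :=
  Matrix.of fun t s => if φ t ≠ z ∧ s = φ t then 1 else 0

theorem cutGraph_mulVec (φ : ι → ι) (z : ι) (u : ι → ℤ) (t : ι) :
    (cutGraph φ z *ᵥ u) t = if φ t ≠ z then u (φ t) else 0 := by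
  by_cases h : φ t = z <;> simp [cutGraph, mulVec, dotProduct, h]

theorem cutGraph_pow_mulVec (φ : ι → ι) (z : ι) (u : ι → ℤ) (k : ℕ) (t : ι) :
    (cutGraph φ z ^ k *ᵥ u) t =
      if ∀ j < k, φ^[j + 1] t ≠ z then u (φ^[k] t) else 0 := by
  induction k generalizing t with
  | zero => simp
  | succ k ih =>
    have hsucc : (∀ j < k + 1, φ^[j + 1] t ≠ z) ↔ φ t ≠ z ∧ ∀ j < k, φ^[j + 1] (φ t) ≠ z := by
      rw [Nat.forall_lt_succ_left]
      rfl
    rw [pow_succ', ← mulVec_mulVec, cutGraph_mulVec, ih, ← ite_and]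
    exact if_congr hsucc.symm rfl rfl

theorem cutGraph_pow_eq_zero (φ : ι → ι) (z : ι) (m : ℕ)
    (h : ∀ t, ∃ j < m, φ^[j + 1] t = z) : cutGraph φ z ^ m = 0 := by
  refine Matrix.ext_of_mulVec_single fun s => funext fun t => ?_
  rw [cutGraph_pow_mulVec, if_neg, zero_mulVec, Pi.zero_apply]
  push Not
  exact h t

end FunctionalGraph

/-- The left shift of `m`-digit words in base `q`, truncated below at `i`, acting on the words
that are at least `i` (indexed by their difference with `i`). -/
def truncShift (q m i : ℕ) (hi : i < q ^ m) (t : Fin (q ^ m - i)) : Fin (q ^ m - i) :=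
  ⟨q * ((t.val + i) % q ^ (m - 1)) - i, by
    have hq : 0 < q ^ m := by omega
    rcases m.eq_zero_or_pos with rfl | hm
    · have : i = 0 := by simpa using hi
      subst this
      simp [Nat.mod_one]
    · have h1 : q ^ m = q * q ^ (m - 1) := by
        rw [← pow_succ', Nat.sub_add_cancel hm]
      have h2 : 0 < q ^ (m - 1) := Nat.pos_of_mul_pos_left (h1 ▸ hq)
      have h3 : 0 < q := Nat.pos_of_mul_pos_right (h1 ▸ hq)
      have h4 := Nat.mul_lt_mul_of_pos_left (Nat.mod_lt (t.val + i) h2) h3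
      omega⟩

section TruncShift

variable {q m i : ℕ} (hi : i < q ^ m)

theorem truncShift_iterate_val_add (t : Fin (q ^ m - i)) (k : ℕ) (hk : k ≤ m)
    (h : ∀ j < k, ((truncShift q m i hi)^[j + 1] t).val ≠ 0) :
    ((truncShift q m i hi)^[k] t).val + i = q ^ k * ((t.val + i) % q ^ (m - k)) := by
  induction k with
  | zero => simp [Nat.mod_eq_of_lt (show t.val + i < q ^ m by omega)]
  | succ k ih =>
    have ih' := ih (by omega) fun j hj => h j (by omega)
    have hk0 := h k (by omega)
    rw [Function.iterate_succ_apply'] at hk0 ⊢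
    simp only [truncShift] at hk0 ih' ⊢
    rw [Nat.sub_add_cancel (by omega), ih', show m - 1 = k + (m - (k + 1)) by omega, pow_add,
      Nat.mul_mod_mul_left, Nat.mod_mod_of_dvd _ (pow_dvd_pow q (by omega))]
    ring

theorem truncShift_iterate_succ_val (t : Fin (q ^ m - i)) (k : ℕ) (hk : k < m)
    (h : ∀ j < k, ((truncShift q m i hi)^[j + 1] t).val ≠ 0) :
    ((truncShift q m i hi)^[k + 1] t).val =
      q ^ (k + 1) * ((t.val + i) % q ^ (m - (k + 1))) - i := by
  have ih' := truncShift_iterate_val_add hi t k hk.le h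
  rw [Function.iterate_succ_apply']
  simp only [truncShift] at ih' ⊢
  rw [ih', show m - 1 = k + (m - (k + 1)) by omega, pow_add,
    Nat.mul_mod_mul_left, Nat.mod_mod_of_dvd _ (pow_dvd_pow q (by omega)), pow_succ', mul_assoc]

theorem exists_truncShift_iterate_eq_zero (hi0 : 0 < i) (t : Fin (q ^ m - i)) :
    ∃ j < m, ((truncShift q m i hi)^[j + 1] t).val = 0 := by
  by_contra! h
  have := truncShift_iterate_val_add hi t m le_rfl h
  simp [Nat.mod_one] at this
  omega

end TruncShift

section MinimalPrefix

variable {q m i : ℕ}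

theorem lm_spec (hm : 1 ≤ m) :
    1 ≤ lm q m i ∧ lm q m i ≤ m ∧ rs q i (m - lm q m i) ≤ pt q i (lm q m i) :=
  Nat.sInf_mem (s := {j : ℕ | 1 ≤ j ∧ j ≤ m ∧ rs q i (m - j) ≤ pt q i j})
    ⟨m, hm, le_rfl, by simp [rs, Nat.mod_one]⟩

theorem rs_le_pt_iff (hq : 0 < q) (j : ℕ) :
    rs q i (m - j) ≤ pt q i j ↔ q ^ j * (i % q ^ (m - j)) ≤ i := by
  rw [rs, pt, Nat.le_div_iff_mul_le (pow_pos hq j), mul_comm]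

theorem mul_mod_le_of_lm (hq : 0 < q) (hm : 1 ≤ m) :
    q ^ lm q m i * (i % q ^ (m - lm q m i)) ≤ i :=
  (rs_le_pt_iff hq _).mp (lm_spec hm).2.2

theorem lt_mul_mod_of_lt_lm (hq : 0 < q) (hm : 1 ≤ m) {j : ℕ} (hj : 1 ≤ j)
    (hjl : j < lm q m i) : i < q ^ j * (i % q ^ (m - j)) := by
  by_contra! h
  exact Nat.notMem_of_lt_sInf hjl
    ⟨hj, hjl.le.trans (lm_spec hm).2.1, (rs_le_pt_iff hq j).mpr h⟩

theorem forall_truncShift_ne_zero_iff (hq : 0 < q) (hm : 1 ≤ m) (hi : i < q ^ m)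
    (z : Fin (q ^ m - i)) (hz : z.val = 0) (k : ℕ) :
    (∀ j < k, ((truncShift q m i hi)^[j + 1] z).val ≠ 0) ↔ k < lm q m i := by
  obtain ⟨hl1, hlm, -⟩ := lm_spec (q := q) (i := i) hm
  constructor
  · intro h
    by_contra! hk
    refine h (lm q m i - 1) (by omega) ?_
    rw [truncShift_iterate_succ_val hi z _ (by omega) fun j hj => h j (by omega), hz,
      Nat.sub_add_cancel hl1, zero_add]
    have := mul_mod_le_of_lm (i := i) hq hm
    omega
  · induction k with
    | zero => simp
    | succ k ih =>
      intro hk j hj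
      have ih' := ih (by omega)
      rcases Nat.lt_succ_iff_lt_or_eq.mp hj with hj | rfl
      · exact ih' j hj
      · rw [truncShift_iterate_succ_val hi z _ (by omega) ih', hz, zero_add]
        have := lt_mul_mod_of_lt_lm (i := i) hq hm (by omega) hk
        omega

theorem mp_eq : mp q m i = q ^ (m - lm q m i) * (i / q ^ (m - lm q m i)) := by
  have := Nat.div_add_mod i (q ^ (m - lm q m i))
  rw [mp, rs]
  omega

/-- The last digit of the minimal prefix is nonzero. -/
theorem div_pow_lm_mod_ne_zero (hq : 2 ≤ q) (hm : 1 ≤ m) (hi0 : 0 < i) (hi : i < q ^ m) :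
    i / q ^ (m - lm q m i) % q ≠ 0 := by
  obtain ⟨hl1, hlm, -⟩ := lm_spec (q := q) (i := i) hm
  have hle := mul_mod_le_of_lm (i := i) (by omega : 0 < q) hm
  have hlt := fun j => lt_mul_mod_of_lt_lm (q := q) (m := m) (i := i) (j := j) (by omega) hm
  generalize lm q m i = l at *
  intro h0
  have hmod : i % q ^ (m - (l - 1)) = i % q ^ (m - l) := by
    rw [show m - (l - 1) = m - l + 1 by omega, pow_succ, Nat.mod_mul, h0]
    simp
  have hpow : q ^ l = q * q ^ (l - 1) := by rw [← pow_succ', Nat.sub_add_cancel hl1]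
  rw [← hmod, hpow, mul_assoc] at hle
  rcases hl1.eq_or_lt with rfl | hl
  · simp only [Nat.sub_self, pow_zero, one_mul, Nat.sub_zero, Nat.mod_eq_of_lt hi] at hle
    nlinarith
  · have := hlt (l - 1) (by omega) (by omega)
    nlinarith

theorem mp_pos (hq : 2 ≤ q) (hm : 1 ≤ m) (hi0 : 0 < i) (hi : i < q ^ m) : 0 < mp q m i := by
  rw [mp_eq]
  refine Nat.mul_pos (by positivity) (Nat.pos_of_ne_zero fun h => ?_)
  exact div_pow_lm_mod_ne_zero hq hm hi0 hi (by simp [h])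

/-- Base-`q` digits of the complement of a number with nonzero last digit. -/
theorem sub_div_pow_mod {q l p s : ℕ} (hq : 2 ≤ q) (hp : p < q ^ l) (hpq : p % q ≠ 0)
    (hs : s < l) :
    (q ^ l - p) / q ^ s % q + p / q ^ s % q + 1 = q + if s = 0 then 1 else 0 := by
  have hp0 : 0 < p := Nat.pos_of_ne_zero fun h => hpq (by simp [h])
  have hcompl : (q ^ l - p) / q ^ s = q ^ (l - s) - ((p - 1) / q ^ s + 1) := by
    have h := Nat.mul_sub_div (p - 1) (q ^ s) (q ^ (l - s))
      (by rw [← pow_add, Nat.add_sub_cancel' hs.le]; omega)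
    rwa [← pow_add, Nat.add_sub_cancel' hs.le, Nat.sub_add_cancel hp0] at h
  have hlt : (p - 1) / q ^ s < q ^ (l - s) := by
    rw [Nat.div_lt_iff_lt_mul (by positivity), ← pow_add, Nat.sub_add_cancel hs.le]
    omega
  have hcmod : (q ^ (l - s) - ((p - 1) / q ^ s + 1)) % q = q - ((p - 1) / q ^ s % q + 1) := by
    obtain ⟨d, hd⟩ : ∃ d, l - s = d + 1 := ⟨l - s - 1, by omega⟩
    rw [hd, pow_succ'] at hlt ⊢
    generalize (p - 1) / q ^ s = x at *
    have h1 := Nat.div_add_mod x q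
    have h2 := Nat.mod_lt x (by omega : 0 < q)
    have h3 : x / q < q ^ d := by
      rw [Nat.div_lt_iff_lt_mul (by omega), mul_comm]; exact hlt
    have h4 : q * q ^ d - (x + 1) = q - (x % q + 1) + q * (q ^ d - 1 - x / q) := by
      obtain ⟨e, he⟩ := Nat.exists_eq_add_of_lt h3
      rw [he, show x / q + e + 1 - 1 - x / q = e by omega]
      have : q * (x / q + e + 1) = q * (x / q) + q * e + q := by ring
      omega
    rw [h4, Nat.add_mul_mod_self_left, Nat.mod_eq_of_lt (by omega)]
  rw [hcompl, hcmod]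
  have h5 := Nat.mod_lt ((p - 1) / q ^ s) (by omega : 0 < q)
  have hpm : p - 1 = q * (p / q) + (p % q - 1) := by
    have := Nat.div_add_mod p q; omega
  have h6 := Nat.mod_lt p (by omega : 0 < q)
  split_ifs with h
  · subst h
    have h7 : (p - 1) % q = p % q - 1 := by
      rw [hpm, Nat.mul_add_mod, Nat.mod_eq_of_lt (by omega)]
    simp only [pow_zero, Nat.div_one] at *
    omega
  · have h7 : (p - 1) / q ^ s = p / q ^ s := by
      obtain ⟨d, rfl⟩ : ∃ d, s = d + 1 := ⟨s - 1, by omega⟩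
      rw [pow_succ', ← Nat.div_div_eq_div_mul, ← Nat.div_div_eq_div_mul]
      congr 1
      rw [hpm, Nat.mul_add_div (by omega), Nat.div_eq_of_lt (by omega : p % q - 1 < q), add_zero]
    rw [h7] at h5 ⊢
    omega

theorem digit_of_lt_lm (hq : 2 ≤ q) (hm : 1 ≤ m) (hi0 : 0 < i) (hi : i < q ^ m) {k : ℕ}
    (hk : k < lm q m i) :
    (q ^ m - mp q m i) / q ^ (m - (k + 1)) % q + i / q ^ (m - (k + 1)) % q + 1 =
      q + if k + 1 = lm q m i then 1 else 0 := by
  have hpq := div_pow_lm_mod_ne_zero hq hm hi0 hi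
  obtain ⟨hl1, hlm, -⟩ := lm_spec (q := q) (i := i) hm
  rw [mp_eq]
  generalize lm q m i = l at *
  have hpl : i / q ^ (m - l) < q ^ l := by
    rw [Nat.div_lt_iff_lt_mul (by positivity), ← pow_add, Nat.add_sub_cancel' hlm]
    exact hi
  have h := sub_div_pow_mod hq hpl hpq (s := l - (k + 1)) (by omega)
  have h1 : q ^ (m - (k + 1)) = q ^ (m - l) * q ^ (l - (k + 1)) := by
    rw [← pow_add]; congr 1; omega
  have h2 : q ^ m = q ^ (m - l) * q ^ l := by
    rw [← pow_add]; congr 1; omega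
  rw [h2, ← Nat.mul_sub, h1, Nat.mul_div_mul_left _ _ (by positivity),
    ← Nat.div_div_eq_div_mul, h]
  congr 1
  exact if_congr (by omega) rfl rfl

theorem digit_of_lm_le (hq : 2 ≤ q) (hm : 1 ≤ m) {k : ℕ} (hkm : k < m) (hk : lm q m i ≤ k) :
    (q ^ m - mp q m i) / q ^ (m - (k + 1)) % q = 0 := by
  obtain ⟨hl1, hlm, -⟩ := lm_spec (q := q) (i := i) hm
  rw [mp_eq]
  generalize lm q m i = l at *
  have h1 : q ^ (m - l) = q ^ (m - (k + 1)) * (q * q ^ (k - l)) := by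
    rw [← pow_succ', ← pow_add]; congr 1; omega
  have h2 : q ^ m = q ^ (m - l) * q ^ l := by
    rw [← pow_add]; congr 1; omega
  rw [h2, ← Nat.mul_sub, h1, mul_assoc, Nat.mul_div_cancel_left _ (by positivity), mul_assoc,
    Nat.mul_mod_right]

theorem sum_div_pow_mod_mul_pow (q m n : ℕ) (hn : n < q ^ m) :
    ∑ j ∈ Finset.range m, n / q ^ (m - (j + 1)) % q * q ^ (m - (j + 1)) = n := by
  have key : ∀ k, ∑ j ∈ Finset.range k, n / q ^ j % q * q ^ j = n % q ^ k := by
    intro k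
    induction k with
    | zero => simp [Nat.mod_one]
    | succ k ih => rw [Finset.sum_range_succ, ih, pow_succ, Nat.mod_mul, mul_comm (q ^ k)]
  refine Eq.trans ?_ ((key m).trans (Nat.mod_eq_of_lt hn))
  rw [← Finset.sum_range_reflect]
  refine Finset.sum_congr rfl fun j hj => ?_
  have := Finset.mem_range.mp hj
  rw [show m - (m - 1 - j + 1) = j by omega]

end MinimalPrefix

section Conjugation

open Matrix

/-- Rows of this matrix are the indicator functions of final segments. -/
def tailMatrix (n : ℕ) : Matrix (Fin n) (Fin n) ℤ :=
  Matrix.of fun t b => if t ≤ b then 1 else 0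

theorem det_tailMatrix (n : ℕ) : (tailMatrix n).det = 1 := by
  rw [det_of_isUpperTriangular]
  · simp [tailMatrix]
  · intro a b hab
    simp only [id] at hab
    simp [tailMatrix, hab]

theorem card_filter_mod_eq {q Q T c : ℕ} (hc : c < Q) (hT : T < q * Q) :
    ((Finset.Ico T (q * Q)).filter fun x => x % Q = c).card + T / Q + 1 =
      q + if T % Q ≤ c then 1 else 0 := by
  have hQ : 0 < Q := by omega
  have hcount : ∀ b, ((Finset.range b).filter fun x => x % Q = c).card =
      b / Q + if c < b % Q then 1 else 0 := by
    intro b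
    have h := Nat.count_modEq_card b hQ c
    rw [Nat.count_eq_card_filter_range, Nat.mod_eq_of_lt hc] at h
    rw [← h]
    congr 1
    refine Finset.filter_congr fun x _ => ?_
    rw [Nat.ModEq, Nat.mod_eq_of_lt hc]
  have hsplit : ((Finset.range (q * Q)).filter fun x => x % Q = c).card =
      ((Finset.range T).filter fun x => x % Q = c).card +
        ((Finset.Ico T (q * Q)).filter fun x => x % Q = c).card := by
    simp only [Finset.card_filter]
    exact (Finset.sum_range_add_sum_Ico _ hT.le).symm
  rw [hcount, hcount, Nat.mul_div_cancel _ hQ, Nat.mul_mod_left] at hsplit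
  split_ifs at hsplit ⊢ <;> omega

theorem tailMatrix_mul_Adel {q m i : ℕ} (hq : 0 < q) (hm : 1 ≤ m) (hi : i < q ^ m)
    (z : Fin (q ^ m - i)) (hz : z.val = 0) :
    tailMatrix (q ^ m - i) * Adel q m i hi.le =
      (cutGraph (truncShift q m i hi) z +
        vecMulVec (fun t => (q : ℤ) - 1 - ((t.val + i) / q ^ (m - 1) : ℕ) +
          if truncShift q m i hi t = z then 1 else 0) (Pi.single z 1)) *
        tailMatrix (q ^ m - i) := by
  have hpow : q ^ m = q * q ^ (m - 1) := by rw [← pow_succ', Nat.sub_add_cancel hm]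
  have hz' : ∀ b, z ≤ b := fun b => by rw [Fin.le_def, hz]; exact Nat.zero_le _
  ext t b
  have hc : (b.val + i) / q < q ^ (m - 1) := by
    rw [Nat.div_lt_iff_lt_mul hq, mul_comm, ← hpow]; omega
  have hcard := card_filter_mod_eq (q := q) (T := t.val + i) hc (by omega)
  have hlhs : (tailMatrix (q ^ m - i) * Adel q m i hi.le) t b =
      (((Finset.Ico (t.val + i) (q ^ m)).filter
        fun x => x % q ^ (m - 1) = (b.val + i) / q).card : ℤ) := by
    rw [Matrix.mul_apply, Finset.card_filter, Nat.cast_sum]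
    let w : ℕ → ℤ := fun a => if t.val ≤ a then
      ((if (a + i) % q ^ (m - 1) = (b.val + i) / q then 1 else 0 : ℕ) : ℤ) else 0
    have h1 : ∀ a : Fin (q ^ m - i),
        tailMatrix (q ^ m - i) t a * Adel q m i hi.le a b = w a.val := by
      intro a
      simp only [tailMatrix, Adel, A, rs, pt, Fin.le_def, Matrix.of_apply,
        Matrix.submatrix_apply, pow_one, w]
      split_ifs <;> rfl
    rw [Finset.sum_congr rfl fun a _ => h1 a, Fin.sum_univ_eq_sum_range w, ← Finset.sum_filter]
    refine Finset.sum_bij' (fun a _ => a + i) (fun x _ => x - i) ?_ ?_ ?_ ?_ ?_ <;>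
      simp only [Finset.mem_filter, Finset.mem_range, Finset.mem_Ico] <;> intros <;>
      first | omega | trivial
  have hshift : truncShift q m i hi t ≤ b ↔ (t.val + i) % q ^ (m - 1) ≤ (b.val + i) / q := by
    rw [Fin.le_def, Nat.le_div_iff_mul_le hq, mul_comm _ q]
    simp only [truncShift]
    omega
  have hrhs : (cutGraph (truncShift q m i hi) z * tailMatrix (q ^ m - i)) t b =
      if truncShift q m i hi t ≠ z then
        tailMatrix (q ^ m - i) (truncShift q m i hi t) b else 0 :=
    cutGraph_mulVec (truncShift q m i hi) z (fun s => tailMatrix (q ^ m - i) s b) t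
  have hvec : ∀ u : Fin (q ^ m - i) → ℤ,
      (vecMulVec u (Pi.single z 1) * tailMatrix (q ^ m - i)) t b = u t := by
    intro u
    rw [Matrix.mul_apply, Finset.sum_eq_single z]
    · simp [vecMulVec_apply, tailMatrix, hz']
    · intro s _ hs
      simp [vecMulVec_apply, hs]
    · simp
  rw [hlhs, Matrix.add_mul, Matrix.add_apply, hrhs, hvec]
  rw [← hpow] at hcard
  simp only [tailMatrix, Matrix.of_apply, hshift]
  have hcard' := congrArg (Nat.cast : ℕ → ℤ) hcard
  by_cases h : truncShift q m i hi t = z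
  · have := hshift.mp (h ▸ hz' b)
    simp only [this, h, if_true] at hcard' ⊢
    push_cast at hcard' ⊢
    simp
    linarith
  · simp only [h, ne_eq, not_false_eq_true, if_true, if_false]
    push_cast at hcard' ⊢
    linarith

theorem charpoly_eq_of_mul_eq_mul {n : Type*} [Fintype n] [DecidableEq n]
    {E B M : Matrix n n ℤ} (hE : E.det = 1) (h : E * B = M * E) : B.charpoly = M.charpoly := by
  have hu : IsUnit E := (isUnit_iff_isUnit_det E).mpr (by simp [hE])
  obtain ⟨U, rfl⟩ := hu
  rw [← charpoly_units_conj U B, h, Matrix.mul_assoc, Matrix.mul_nonsing_inv _ (by simp [hE]), Matrix.mul_one]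

end Conjugation

theorem cutGraph_truncShift_pow_mulVec_apply {q m i : ℕ} (hq : 2 ≤ q) (hm : 1 ≤ m)
    (hi0 : 0 < i) (hi : i < q ^ m) (z : Fin (q ^ m - i)) (hz : z.val = 0) {k : ℕ} (hk : k < m) :
    (cutGraph (truncShift q m i hi) z ^ k).mulVec
      (fun t => (q : ℤ) - 1 - ((t.val + i) / q ^ (m - 1) : ℕ) +
        if truncShift q m i hi t = z then 1 else 0) z =
      (((q ^ m - mp q m i) / q ^ (m - (k + 1)) % q : ℕ) : ℤ) := by
  have hzero : ∀ t, t = z ↔ t.val = 0 := fun t => by rw [Fin.ext_iff, hz]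
  have hret := forall_truncShift_ne_zero_iff (by omega : 0 < q) hm hi z hz
  rw [cutGraph_pow_mulVec]
  simp only [ne_eq, hzero]
  simp only [← ne_eq, hret]
  by_cases hkl : k < lm q m i
  · have hprev := (hret k).mpr hkl
    have hback : (truncShift q m i hi ((truncShift q m i hi)^[k] z)).val = 0 ↔
        k + 1 = lm q m i := by
      rw [← Function.iterate_succ_apply' (truncShift q m i hi)]
      have h := hret (k + 1)
      rw [Nat.forall_lt_succ_right, and_iff_right hprev] at h
      rw [← not_iff_not, ← ne_eq, h]
      omega
    have hval : (((truncShift q m i hi)^[k] z).val + i) / q ^ (m - 1) =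
        i / q ^ (m - (k + 1)) % q := by
      rw [truncShift_iterate_val_add hi z k hk.le hprev, hz, zero_add,
        show m - 1 = k + (m - (k + 1)) by omega, pow_add,
        Nat.mul_div_mul_left _ _ (by positivity), show m - k = m - (k + 1) + 1 by omega,
        pow_succ, Nat.mod_mul_right_div_self]
    have hdigit := congrArg (Nat.cast : ℕ → ℤ) (digit_of_lt_lm hq hm hi0 hi hkl)
    rw [if_pos hkl, hval]
    simp only [hback]
    rw [Nat.cast_add, Nat.cast_add, Nat.cast_add, Nat.cast_ite] at hdigit
    simp only [Nat.cast_one, Nat.cast_zero] at hdigit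
    linarith
  · rw [if_neg hkl, digit_of_lm_le hq hm hk (by omega), Nat.cast_zero]

open Polynomial in
/-- Main theorem: the characteristic polynomial of `A_m(i)` is
`g_i^m(x) · x^(q^m - m - i)` where `g_i^m(x) = x^m - a₁x^(m-1) - ⋯ - aₘ` and
`a₁a₂⋯aₘ` is the base-`q` expansion of `q^m - ī_m`.  (The identity is stated
multiplied through by `x^(m+i)` so that all exponents are nonnegative.)
In particular `g_i^m(q) = ī_m`. -/
theorem charpoly_A (q m : ℕ) (hq : 2 ≤ q) (hm : 1 ≤ m) (i : ℕ)
    (hi0 : 0 < i) (hi : i < q ^ m) :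
    ((Adel q m i hi.le).charpoly * X ^ (m + i) =
      (X ^ m - ∑ j ∈ Finset.range m,
        C (((q ^ m - mp q m i) / q ^ (m - (j + 1)) % q : ℕ) : ℤ) * X ^ (m - (j + 1)))
        * X ^ (q ^ m)) ∧
    (X ^ m - ∑ j ∈ Finset.range m,
        C (((q ^ m - mp q m i) / q ^ (m - (j + 1)) % q : ℕ) : ℤ) * X ^ (m - (j + 1)) :
      Polynomial ℤ).eval (q : ℤ) = (mp q m i : ℤ) := by
  let z : Fin (q ^ m - i) := ⟨0, by omega⟩
  constructor
  · rw [charpoly_eq_of_mul_eq_mul (det_tailMatrix _)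
      (tailMatrix_mul_Adel (by omega) hm hi z rfl), pow_add, ← mul_assoc,
      charpoly_add_vecMulVec_of_pow_eq_zero _ _ _ m
        (cutGraph_pow_eq_zero _ _ _ fun t => ?_)]
    · rw [mul_assoc, ← pow_add, Fintype.card_fin, Nat.sub_add_cancel hi.le]
      congr 2
      refine Finset.sum_congr rfl fun k hk => ?_
      rw [single_one_dotProduct,
        cutGraph_truncShift_pow_mulVec_apply hq hm hi0 hi z rfl (Finset.mem_range.mp hk)]
    · obtain ⟨j, hj, h⟩ := exists_truncShift_iterate_eq_zero hi hi0 t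
      exact ⟨j, hj, Fin.ext h⟩
  · have hpos := mp_pos hq hm hi0 hi
    have hle : mp q m i ≤ q ^ m := (Nat.sub_le _ _).trans hi.le
    have h := congrArg (Nat.cast : ℕ → ℤ)
      (sum_div_pow_mod_mul_pow q m (q ^ m - mp q m i) (by omega))
    rw [Nat.cast_sub hle, Nat.cast_sum] at h
    simp only [Nat.cast_mul, Nat.cast_pow] at h
    simp only [eval_sub, eval_pow, eval_X, eval_finsetSum, eval_mul, eval_C]
    rw [h]
    ring
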